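/- The braided adjoint action ad = (id⊗m)(id⊗κ⊗id)(τ⊗id)(id⊗φ)φ : A → A⊗A of a multi-braided quantum group on itself is counital and coassociative: (id⊗ε)∘ad = id and (id⊗φ)∘ad = (ad⊗id)∘ad. -/

import Mathlib

open TensorProduct

noncomputable section

variable {A : Type} {Γ : Type} [Ring A] [Algebra ℂ A] [AddCommGroup Γ] [Module ℂ Γ]

/-- A first-order differential calculus over the unital ℂ-algebra `A`:
a unital `A`-bimodule `Γ` with a differential `d` satisfying the Leibniz rule,
such that `ι^l(a ⊗ b) = a · d b` is surjective. -/
structure FODC (A Γ : Type) [Ring A] [Algebra ℂ A] [AddCommGroup Γ] [Module ℂ Γ] where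
  ml : A ⊗[ℂ] Γ →ₗ[ℂ] Γ
  mr : Γ ⊗[ℂ] A →ₗ[ℂ] Γ
  d : A →ₗ[ℂ] Γ
  ml_assoc : ∀ (a b : A) (x : Γ), ml (a ⊗ₜ ml (b ⊗ₜ x)) = ml ((a * b) ⊗ₜ x)
  mr_assoc : ∀ (x : Γ) (a b : A), mr (mr (x ⊗ₜ a) ⊗ₜ b) = mr (x ⊗ₜ (a * b))
  mid_assoc : ∀ (a : A) (x : Γ) (b : A), ml (a ⊗ₜ mr (x ⊗ₜ b)) = mr (ml (a ⊗ₜ x) ⊗ₜ b)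
  one_ml : ∀ x : Γ, ml ((1 : A) ⊗ₜ x) = x
  mr_one : ∀ x : Γ, mr (x ⊗ₜ (1 : A)) = x
  leibniz : ∀ a b : A, d (a * b) = ml (a ⊗ₜ d b) + mr (d a ⊗ₜ b)
  surj : Function.Surjective (ml ∘ₗ LinearMap.lTensor A d)

/-- `ι^l = m^l ∘ (id ⊗ d)`. -/
def FODC.iotaL (C : FODC A Γ) : A ⊗[ℂ] A →ₗ[ℂ] Γ := C.ml ∘ₗ LinearMap.lTensor A C.d

/-- `ι^r = m^r ∘ (d ⊗ id)`. -/
def FODC.iotaR (C : FODC A Γ) : A ⊗[ℂ] A →ₗ[ℂ] Γ := C.mr ∘ₗ LinearMap.rTensor A C.d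

/-- `σ` is a braid operator compatible with the multiplication:
`σ(m⊗id) = (id⊗m)(σ⊗id)(id⊗σ)` and `σ(id⊗m) = (m⊗id)(id⊗σ)(σ⊗id)`. -/
def IsBraid (σ : A ⊗[ℂ] A →ₗ[ℂ] A ⊗[ℂ] A) : Prop :=
  (∀ a b c : A, σ ((a * b) ⊗ₜ c) =
      (LinearMap.lTensor A (LinearMap.mul' ℂ A))
        ((TensorProduct.assoc ℂ A A A)
          ((LinearMap.rTensor A σ)
            ((TensorProduct.assoc ℂ A A A).symm (a ⊗ₜ σ (b ⊗ₜ c)))))) ∧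
  (∀ a b c : A, σ (a ⊗ₜ (b * c)) =
      (LinearMap.rTensor A (LinearMap.mul' ℂ A))
        ((TensorProduct.assoc ℂ A A A).symm
          ((LinearMap.lTensor A σ)
            ((TensorProduct.assoc ℂ A A A)
              ((LinearMap.rTensor A σ) ((a ⊗ₜ b) ⊗ₜ c))))))

/-- `ℓσ` is a left flip-over operator for `σ`: `ℓσ(ι^l⊗id) = (id⊗ι^l)(σ⊗id)(id⊗σ)`. -/
def IsLeftFlip (C : FODC A Γ) (σ : A ⊗[ℂ] A →ₗ[ℂ] A ⊗[ℂ] A)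
    (lσ : Γ ⊗[ℂ] A →ₗ[ℂ] A ⊗[ℂ] Γ) : Prop :=
  lσ ∘ₗ LinearMap.rTensor A C.iotaL =
    LinearMap.lTensor A C.iotaL ∘ₗ (TensorProduct.assoc ℂ A A A).toLinearMap ∘ₗ
      LinearMap.rTensor A σ ∘ₗ (TensorProduct.assoc ℂ A A A).symm.toLinearMap ∘ₗ
      LinearMap.lTensor A σ ∘ₗ (TensorProduct.assoc ℂ A A A).toLinearMap

/-- `rσ` is a right flip-over operator for `σ`: `rσ(id⊗ι^r) = (ι^r⊗id)(id⊗σ)(σ⊗id)`. -/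
def IsRightFlip (C : FODC A Γ) (σ : A ⊗[ℂ] A →ₗ[ℂ] A ⊗[ℂ] A)
    (rσ : A ⊗[ℂ] Γ →ₗ[ℂ] Γ ⊗[ℂ] A) : Prop :=
  rσ ∘ₗ LinearMap.lTensor A C.iotaR =
    LinearMap.rTensor A C.iotaR ∘ₗ (TensorProduct.assoc ℂ A A A).symm.toLinearMap ∘ₗ
      LinearMap.lTensor A σ ∘ₗ (TensorProduct.assoc ℂ A A A).toLinearMap ∘ₗ
      LinearMap.rTensor A σ ∘ₗ (TensorProduct.assoc ℂ A A A).symm.toLinearMap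

/-- Apply `σ` to the middle two factors of `(A⊗A)⊗(A⊗A)`, i.e. `id⊗σ⊗id`. -/
def midBraid (σ : A ⊗[ℂ] A →ₗ[ℂ] A ⊗[ℂ] A) :
    (A ⊗[ℂ] A) ⊗[ℂ] (A ⊗[ℂ] A) →ₗ[ℂ] (A ⊗[ℂ] A) ⊗[ℂ] (A ⊗[ℂ] A) :=
  (TensorProduct.assoc ℂ A A (A ⊗[ℂ] A)).symm.toLinearMap ∘ₗ
    LinearMap.lTensor A ((TensorProduct.assoc ℂ A A A).toLinearMap ∘ₗ
      LinearMap.rTensor A σ ∘ₗ (TensorProduct.assoc ℂ A A A).symm.toLinearMap) ∘ₗ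
    (TensorProduct.assoc ℂ A A (A ⊗[ℂ] A)).toLinearMap

/-- Apply `σ` to the middle two factors of `(A⊗A)⊗(A⊗Γ)`, i.e. `id⊗σ⊗id`. -/
def midBraidM (σ : A ⊗[ℂ] A →ₗ[ℂ] A ⊗[ℂ] A) :
    (A ⊗[ℂ] A) ⊗[ℂ] (A ⊗[ℂ] Γ) →ₗ[ℂ] (A ⊗[ℂ] A) ⊗[ℂ] (A ⊗[ℂ] Γ) :=
  (TensorProduct.assoc ℂ A A (A ⊗[ℂ] Γ)).symm.toLinearMap ∘ₗ
    LinearMap.lTensor A ((TensorProduct.assoc ℂ A A Γ).toLinearMap ∘ₗ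
      LinearMap.rTensor Γ σ ∘ₗ (TensorProduct.assoc ℂ A A Γ).symm.toLinearMap) ∘ₗ
    (TensorProduct.assoc ℂ A A (A ⊗[ℂ] Γ)).toLinearMap

/-- Braided multiplicativity of the coproduct: `φm = (m⊗m)(id⊗σ⊗id)(φ⊗φ)`. -/
def CompMul (φ : A →ₗ[ℂ] A ⊗[ℂ] A) (σ : A ⊗[ℂ] A →ₗ[ℂ] A ⊗[ℂ] A) : Prop :=
  ∀ a b : A, φ (a * b) =
    (TensorProduct.map (LinearMap.mul' ℂ A) (LinearMap.mul' ℂ A))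
      (midBraid σ (φ a ⊗ₜ φ b))

/-- Coassociativity: `(φ⊗id)φ = (id⊗φ)φ`. -/
def IsCoassoc (φ : A →ₗ[ℂ] A ⊗[ℂ] A) : Prop :=
  ∀ a : A, (TensorProduct.assoc ℂ A A A) ((LinearMap.rTensor A φ) (φ a)) =
    (LinearMap.lTensor A φ) (φ a)

/-- Counit property: `(ε⊗id)φ = id = (id⊗ε)φ`. -/
def IsCounit (φ : A →ₗ[ℂ] A ⊗[ℂ] A) (ε : A →ₗ[ℂ] ℂ) : Prop :=
  (∀ a : A, (TensorProduct.lid ℂ A) ((LinearMap.rTensor A ε) (φ a)) = a) ∧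
  (∀ a : A, (TensorProduct.rid ℂ A) ((LinearMap.lTensor A ε) (φ a)) = a)

/-- Antipode property: `m(κ⊗id)φ = 1ε = m(id⊗κ)φ`. -/
def IsAntipode (φ : A →ₗ[ℂ] A ⊗[ℂ] A) (ε : A →ₗ[ℂ] ℂ) (κ : A →ₗ[ℂ] A) : Prop :=
  (∀ a : A, LinearMap.mul' ℂ A
      ((TensorProduct.map κ (LinearMap.id : A →ₗ[ℂ] A)) (φ a)) = ε a • 1) ∧
  (∀ a : A, LinearMap.mul' ℂ A
      ((TensorProduct.map (LinearMap.id : A →ₗ[ℂ] A) κ) (φ a)) = ε a • 1)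

/-- The secondary braid operator: `τ = (ε⊗id²)(σ⁻¹⊗id)(id⊗φ)σ`. -/
def IsTau (φ : A →ₗ[ℂ] A ⊗[ℂ] A) (ε : A →ₗ[ℂ] ℂ)
    (σ : A ⊗[ℂ] A ≃ₗ[ℂ] A ⊗[ℂ] A) (τ : A ⊗[ℂ] A →ₗ[ℂ] A ⊗[ℂ] A) : Prop :=
  ∀ x : A ⊗[ℂ] A, τ x =
    (TensorProduct.lid ℂ (A ⊗[ℂ] A))
      ((LinearMap.rTensor (A ⊗[ℂ] A) ε)
        ((TensorProduct.assoc ℂ A A A)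
          ((LinearMap.rTensor A σ.symm.toLinearMap)
            ((TensorProduct.assoc ℂ A A A).symm ((LinearMap.lTensor A φ) (σ x))))))

/-- `ℓ` is the left action of the group on `Γ`: `ℓ ι^l = (m⊗ι^l)(id⊗σ⊗id)(φ⊗φ)`. -/
def IsLeftAction (C : FODC A Γ) (φ : A →ₗ[ℂ] A ⊗[ℂ] A)
    (σ : A ⊗[ℂ] A →ₗ[ℂ] A ⊗[ℂ] A) (ℓ : Γ →ₗ[ℂ] A ⊗[ℂ] Γ) : Prop :=
  ∀ a b : A, ℓ (C.ml (a ⊗ₜ C.d b)) =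
    (TensorProduct.map (LinearMap.mul' ℂ A) C.iotaL) (midBraid σ (φ a ⊗ₜ φ b))

/-- `ρ` is the right action of the group on `Γ`: `ρ ι^l = (ι^l⊗m)(id⊗σ⊗id)(φ⊗φ)`. -/
def IsRightAction (C : FODC A Γ) (φ : A →ₗ[ℂ] A ⊗[ℂ] A)
    (σ : A ⊗[ℂ] A →ₗ[ℂ] A ⊗[ℂ] A) (ρ : Γ →ₗ[ℂ] Γ ⊗[ℂ] A) : Prop :=
  ∀ a b : A, ρ (C.ml (a ⊗ₜ C.d b)) =
    (TensorProduct.map C.iotaL (LinearMap.mul' ℂ A)) (midBraid σ (φ a ⊗ₜ φ b))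

/-- Left multiplicativity of the left action: `ℓ m^l = (m⊗m^l)(id⊗σ⊗id)(φ⊗ℓ)`. -/
def LeftActionMul (C : FODC A Γ) (φ : A →ₗ[ℂ] A ⊗[ℂ] A)
    (σ : A ⊗[ℂ] A →ₗ[ℂ] A ⊗[ℂ] A) (ℓ : Γ →ₗ[ℂ] A ⊗[ℂ] Γ) : Prop :=
  ∀ (a : A) (x : Γ), ℓ (C.ml (a ⊗ₜ x)) =
    (TensorProduct.map (LinearMap.mul' ℂ A) C.ml) (midBraidM σ (φ a ⊗ₜ ℓ x))

/-- Counitality of the left action: `(ε⊗id)ℓ = id`. -/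
def LeftActionCounit (ε : A →ₗ[ℂ] ℂ) (ℓ : Γ →ₗ[ℂ] A ⊗[ℂ] Γ) : Prop :=
  ∀ x : Γ, (TensorProduct.lid ℂ Γ) ((LinearMap.rTensor Γ ε) (ℓ x)) = x

/-- Coassociativity of the left action: `(φ⊗id)ℓ = (id⊗ℓ)ℓ`. -/
def LeftActionCoassoc (φ : A →ₗ[ℂ] A ⊗[ℂ] A) (ℓ : Γ →ₗ[ℂ] A ⊗[ℂ] Γ) : Prop :=
  ∀ x : Γ, (TensorProduct.assoc ℂ A A Γ) ((LinearMap.rTensor Γ φ) (ℓ x)) =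
    (LinearMap.lTensor A ℓ) (ℓ x)

/-- A multi-braided quantum group structure on the algebra `A`. -/
structure MultiBraided (A : Type) [Ring A] [Algebra ℂ A] where
  σ : ℤ → (A ⊗[ℂ] A ≃ₗ[ℂ] A ⊗[ℂ] A)
  φ : A →ₗ[ℂ] A ⊗[ℂ] A
  ε : A →ₗ[ℂ] ℂ
  κ : A →ₗ[ℂ] A
  braid : IsBraid (σ 1).toLinearMap
  compMul : CompMul φ (σ 1).toLinearMap
  coassoc : IsCoassoc φ
  counit : IsCounit φ ε
  antipode : IsAntipode φ ε κ
  comul_braid : ∀ n m : ℤ,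
    LinearMap.rTensor A φ ∘ₗ (σ (n + m)).toLinearMap =
      (TensorProduct.assoc ℂ A A A).symm.toLinearMap ∘ₗ
        LinearMap.lTensor A (σ n).toLinearMap ∘ₗ
        (TensorProduct.assoc ℂ A A A).toLinearMap ∘ₗ
        LinearMap.rTensor A (σ m).toLinearMap ∘ₗ
        (TensorProduct.assoc ℂ A A A).symm.toLinearMap ∘ₗ
        LinearMap.lTensor A φ
  comul_braid' : ∀ n m : ℤ,
    LinearMap.lTensor A φ ∘ₗ (σ (n + m)).toLinearMap =
      (TensorProduct.assoc ℂ A A A).toLinearMap ∘ₗ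
        LinearMap.rTensor A (σ n).toLinearMap ∘ₗ
        (TensorProduct.assoc ℂ A A A).symm.toLinearMap ∘ₗ
        LinearMap.lTensor A (σ m).toLinearMap ∘ₗ
        (TensorProduct.assoc ℂ A A A).toLinearMap ∘ₗ
        LinearMap.rTensor A φ
  braid_antipode : ∀ (n : ℤ) (x : A ⊗[ℂ] A),
    (σ n) ((TensorProduct.map (LinearMap.id : A →ₗ[ℂ] A) κ) x) =
      (TensorProduct.map κ (LinearMap.id : A →ₗ[ℂ] A)) ((σ (-n)) x)

namespace MultiBraided

local notation "𝕃" => LinearMap.lTensor A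

section Lift

variable {N₁ N₂ N₃ N₄ N₅ N₆ N₇ : Type}
  [AddCommMonoid N₁] [Module ℂ N₁] [AddCommMonoid N₂] [Module ℂ N₂]
  [AddCommMonoid N₃] [Module ℂ N₃] [AddCommMonoid N₄] [Module ℂ N₄]
  [AddCommMonoid N₅] [Module ℂ N₅] [AddCommMonoid N₆] [Module ℂ N₆]
  [AddCommMonoid N₇] [Module ℂ N₇]

theorem lift₁₀ {f : N₁ →ₗ[ℂ] N₁} (h : ∀ x, f x = x) (x : A ⊗[ℂ] N₁) : 𝕃 f x = x := by
  rw [show f = LinearMap.id from LinearMap.ext h, LinearMap.lTensor_id_apply]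

theorem lift₂₀ {g : N₁ →ₗ[ℂ] N₂} {f : N₂ →ₗ[ℂ] N₁}
    (h : ∀ x, f (g x) = x) (x : A ⊗[ℂ] N₁) : 𝕃 f (𝕃 g x) = x := by
  rw [← LinearMap.lTensor_comp_apply]
  exact lift₁₀ h x

theorem lift₁₁ {f f' : N₁ →ₗ[ℂ] N₂} (h : ∀ x, f x = f' x) (x : A ⊗[ℂ] N₁) :
    𝕃 f x = 𝕃 f' x := by
  rw [show f = f' from LinearMap.ext h]

theorem lift₂₁ {g : N₁ →ₗ[ℂ] N₂} {f : N₂ →ₗ[ℂ] N₃} {f' : N₁ →ₗ[ℂ] N₃}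
    (h : ∀ x, f (g x) = f' x) (x : A ⊗[ℂ] N₁) : 𝕃 f (𝕃 g x) = 𝕃 f' x := by
  rw [← LinearMap.lTensor_comp_apply]
  exact lift₁₁ h x

theorem lift₂₂ {g : N₁ →ₗ[ℂ] N₂} {f : N₂ →ₗ[ℂ] N₃} {g' : N₁ →ₗ[ℂ] N₄} {f' : N₄ →ₗ[ℂ] N₃}
    (h : ∀ x, f (g x) = f' (g' x)) (x : A ⊗[ℂ] N₁) : 𝕃 f (𝕃 g x) = 𝕃 f' (𝕃 g' x) := by
  simp only [← LinearMap.lTensor_comp_apply]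
  exact lift₁₁ h x

theorem lift₃₂ {k : N₁ →ₗ[ℂ] N₂} {g : N₂ →ₗ[ℂ] N₃} {f : N₃ →ₗ[ℂ] N₄}
    {g' : N₁ →ₗ[ℂ] N₅} {f' : N₅ →ₗ[ℂ] N₄}
    (h : ∀ x, f (g (k x)) = f' (g' x)) (x : A ⊗[ℂ] N₁) :
    𝕃 f (𝕃 g (𝕃 k x)) = 𝕃 f' (𝕃 g' x) := by
  simp only [← LinearMap.lTensor_comp_apply]
  exact lift₁₁ h x

theorem lift₂₃ {g' : N₁ →ₗ[ℂ] N₅} {f' : N₅ →ₗ[ℂ] N₄}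
    {k : N₁ →ₗ[ℂ] N₂} {g : N₂ →ₗ[ℂ] N₃} {f : N₃ →ₗ[ℂ] N₄}
    (h : ∀ x, f' (g' x) = f (g (k x))) (x : A ⊗[ℂ] N₁) :
    𝕃 f' (𝕃 g' x) = 𝕃 f (𝕃 g (𝕃 k x)) := by
  simp only [← LinearMap.lTensor_comp_apply]
  exact lift₁₁ h x

theorem lift₂₅ {g' : N₁ →ₗ[ℂ] N₇} {f' : N₇ →ₗ[ℂ] N₆} {a : N₁ →ₗ[ℂ] N₂} {b : N₂ →ₗ[ℂ] N₃}
    {c : N₃ →ₗ[ℂ] N₄} {d : N₄ →ₗ[ℂ] N₅} {e : N₅ →ₗ[ℂ] N₆}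
    (h : ∀ x, f' (g' x) = e (d (c (b (a x))))) (x : A ⊗[ℂ] N₁) :
    𝕃 f' (𝕃 g' x) = 𝕃 e (𝕃 d (𝕃 c (𝕃 b (𝕃 a x)))) := by
  simp only [← LinearMap.lTensor_comp_apply]
  exact lift₁₁ h x

theorem lift₄₁ {a : N₁ →ₗ[ℂ] N₂} {b : N₂ →ₗ[ℂ] N₃} {c : N₃ →ₗ[ℂ] N₄} {d : N₄ →ₗ[ℂ] N₅}
    {f : N₁ →ₗ[ℂ] N₅} (h : ∀ x, d (c (b (a x))) = f x) (x : A ⊗[ℂ] N₁) :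
    𝕃 d (𝕃 c (𝕃 b (𝕃 a x))) = 𝕃 f x := by
  simp only [← LinearMap.lTensor_comp_apply]
  exact lift₁₁ h x

end Lift

section Operators

variable (M : Type) [AddCommMonoid M] [Module ℂ M]

/-- A binary operator acting on the first two factors. -/
def onTwo (f : A ⊗[ℂ] A →ₗ[ℂ] A ⊗[ℂ] A) : A ⊗[ℂ] (A ⊗[ℂ] M) →ₗ[ℂ] A ⊗[ℂ] (A ⊗[ℂ] M) :=
  (TensorProduct.assoc ℂ A A M).toLinearMap ∘ₗ LinearMap.rTensor M f ∘ₗ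
    (TensorProduct.assoc ℂ A A M).symm.toLinearMap

/-- The multiplication on the first two factors. -/
def mu : A ⊗[ℂ] (A ⊗[ℂ] M) →ₗ[ℂ] A ⊗[ℂ] M :=
  LinearMap.rTensor M (LinearMap.mul' ℂ A) ∘ₗ (TensorProduct.assoc ℂ A A M).symm.toLinearMap

/-- Insertion of a unit as the first factor. -/
def un : M →ₗ[ℂ] A ⊗[ℂ] M := TensorProduct.mk ℂ A M 1

variable (G : MultiBraided A)

/-- The braid operator of index `n` on the first two factors. -/
def S (n : ℤ) : A ⊗[ℂ] (A ⊗[ℂ] M) →ₗ[ℂ] A ⊗[ℂ] (A ⊗[ℂ] M) := onTwo M (G.σ n).toLinearMap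

/-- The comultiplication on the first factor. -/
def P : A ⊗[ℂ] M →ₗ[ℂ] A ⊗[ℂ] (A ⊗[ℂ] M) :=
  (TensorProduct.assoc ℂ A A M).toLinearMap ∘ₗ LinearMap.rTensor M G.φ

/-- The counit on the first factor. -/
def E : A ⊗[ℂ] M →ₗ[ℂ] M := (TensorProduct.lid ℂ M).toLinearMap ∘ₗ LinearMap.rTensor M G.ε

/-- The antipode on the first factor. -/
def K : A ⊗[ℂ] M →ₗ[ℂ] A ⊗[ℂ] M := LinearMap.rTensor M G.κ

end Operators

section Laws

variable {M N : Type} [AddCommMonoid M] [Module ℂ M] [AddCommMonoid N] [Module ℂ N]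
variable (G : MultiBraided A)

@[simp] theorem mu_tmul (a b : A) (x : M) :
    mu M (a ⊗ₜ[ℂ] (b ⊗ₜ[ℂ] x)) = (a * b) ⊗ₜ x := rfl

@[simp] theorem un_apply (x : M) : un (A := A) M x = 1 ⊗ₜ x := rfl

@[simp] theorem S_tmul (n : ℤ) (a b : A) (x : M) :
    G.S M n (a ⊗ₜ (b ⊗ₜ x)) = TensorProduct.assoc ℂ A A M (G.σ n (a ⊗ₜ b) ⊗ₜ x) := rfl

@[simp] theorem P_tmul (a : A) (x : M) :
    G.P M (a ⊗ₜ x) = TensorProduct.assoc ℂ A A M (G.φ a ⊗ₜ x) := rfl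

@[simp] theorem E_tmul (a : A) (x : M) : G.E M (a ⊗ₜ x) = G.ε a • x := rfl

@[simp] theorem K_tmul (a : A) (x : M) : G.K M (a ⊗ₜ x) = G.κ a ⊗ₜ x := rfl

theorem S_nat (n : ℤ) (g : M →ₗ[ℂ] N) (x : A ⊗[ℂ] (A ⊗[ℂ] M)) :
    G.S N n (𝕃 (𝕃 g) x) = 𝕃 (𝕃 g) (G.S M n x) := by
  suffices G.S N n ∘ₗ 𝕃 (𝕃 g) = 𝕃 (𝕃 g) ∘ₗ G.S M n from LinearMap.congr_fun this x
  ext a b m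
  simp only [TensorProduct.AlgebraTensorModule.curry_apply, LinearMap.restrictScalars_self,
    TensorProduct.curry_apply, LinearMap.coe_comp, Function.comp_apply, LinearMap.lTensor_tmul,
    S_tmul]
  induction G.σ n (a ⊗ₜ b) with
  | zero => simp
  | tmul => simp
  | add u v hu hv => simp only [TensorProduct.add_tmul, map_add, hu, hv]

theorem mu_nat (g : M →ₗ[ℂ] N) (x : A ⊗[ℂ] (A ⊗[ℂ] M)) :
    mu N (𝕃 (𝕃 g) x) = 𝕃 g (mu M x) := by
  suffices mu N ∘ₗ 𝕃 (𝕃 g) = 𝕃 g ∘ₗ mu (A := A) M from LinearMap.congr_fun this x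
  ext a b m
  rfl

theorem un_nat (g : M →ₗ[ℂ] N) (x : M) : un N (g x) = 𝕃 g (un M x) := rfl

theorem P_nat (g : M →ₗ[ℂ] N) (x : A ⊗[ℂ] M) : G.P N (𝕃 g x) = 𝕃 (𝕃 g) (G.P M x) := by
  suffices G.P N ∘ₗ 𝕃 g = 𝕃 (𝕃 g) ∘ₗ G.P M from LinearMap.congr_fun this x
  ext a m
  simp only [TensorProduct.AlgebraTensorModule.curry_apply, LinearMap.restrictScalars_self,
    TensorProduct.curry_apply, LinearMap.coe_comp, Function.comp_apply, LinearMap.lTensor_tmul,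
    P_tmul]
  induction G.φ a with
  | zero => simp
  | tmul => simp
  | add u v hu hv => simp only [TensorProduct.add_tmul, map_add, hu, hv]

theorem E_nat (g : M →ₗ[ℂ] N) (x : A ⊗[ℂ] M) : G.E N (𝕃 g x) = g (G.E M x) := by
  suffices G.E N ∘ₗ 𝕃 g = g ∘ₗ G.E M from LinearMap.congr_fun this x
  ext a m
  simp

theorem K_nat (g : M →ₗ[ℂ] N) (x : A ⊗[ℂ] M) : G.K N (𝕃 g x) = 𝕃 g (G.K M x) := by
  suffices G.K N ∘ₗ 𝕃 g = 𝕃 g ∘ₗ G.K M from LinearMap.congr_fun this x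
  ext a m
  simp

theorem S_bijective (n : ℤ) : Function.Bijective (G.S M n) := by
  have : G.S M n = ((TensorProduct.assoc ℂ A A M).symm ≪≫ₗ
    (TensorProduct.congr (G.σ n) (LinearEquiv.refl ℂ M)) ≪≫ₗ
      TensorProduct.assoc ℂ A A M).toLinearMap := rfl
  rw [this]
  exact LinearEquiv.bijective _

theorem lTensor_S_injective (n : ℤ) : Function.Injective (𝕃 (G.S M n)) := by
  have : 𝕃 (G.S M n) = (TensorProduct.congr (LinearEquiv.refl ℂ A)
    ((TensorProduct.assoc ℂ A A M).symm ≪≫ₗ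
    (TensorProduct.congr (G.σ n) (LinearEquiv.refl ℂ M)) ≪≫ₗ
      TensorProduct.assoc ℂ A A M)).toLinearMap := rfl
  rw [this]
  exact LinearEquiv.injective _

theorem mu_mu (x : A ⊗[ℂ] (A ⊗[ℂ] (A ⊗[ℂ] M))) :
    mu M (mu (A ⊗[ℂ] M) x) = mu M (𝕃 (mu M) x) := by
  suffices mu M ∘ₗ mu (A ⊗[ℂ] M) = mu M ∘ₗ 𝕃 (mu (A := A) M) from LinearMap.congr_fun this x
  ext a b c m
  simp [mul_assoc]

theorem mu_un (x : A ⊗[ℂ] M) : mu M (un (A ⊗[ℂ] M) x) = x := by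
  suffices mu M ∘ₗ un (A ⊗[ℂ] M) = LinearMap.id (R := ℂ) (M := A ⊗[ℂ] M) from
    LinearMap.congr_fun this x
  ext a m
  simp

theorem mu_lTensor_un (x : A ⊗[ℂ] M) : mu M (𝕃 (un M) x) = x := by
  suffices mu M ∘ₗ 𝕃 (un M) = LinearMap.id (R := ℂ) (M := A ⊗[ℂ] M) from
    LinearMap.congr_fun this x
  ext a m
  simp

theorem P_P (x : A ⊗[ℂ] M) :
    𝕃 (G.P M) (G.P M x) = G.P (A ⊗[ℂ] M) (G.P M x) := by
  induction x with
  | zero => simp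
  | add u v hu hv => simp only [map_add, hu, hv]
  | tmul a m =>
    have h := congrArg (fun z => 𝕃 (TensorProduct.assoc ℂ A A M).toLinearMap
      (TensorProduct.assoc ℂ A (A ⊗[ℂ] A) M (z ⊗ₜ m))) (G.coassoc a)
    simp only [P_tmul]
    refine Eq.trans ?_ (h.symm.trans ?_)
    · induction G.φ a with
      | zero => simp
      | tmul => simp
      | add u v hu hv => simp only [TensorProduct.add_tmul, map_add, hu, hv]
    · induction G.φ a with
      | zero => simp
      | add u v hu hv => simp only [TensorProduct.add_tmul, map_add, hu, hv]
      | tmul b c =>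
        simp only [LinearMap.rTensor_tmul, TensorProduct.assoc_tmul, P_tmul]
        induction G.φ b with
        | zero => simp
        | tmul => simp
        | add u v hu hv => simp only [TensorProduct.add_tmul, map_add, hu, hv]

theorem E_P (x : A ⊗[ℂ] M) : G.E (A ⊗[ℂ] M) (G.P M x) = x := by
  induction x with
  | zero => simp
  | add u v hu hv => simp only [map_add, hu, hv]
  | tmul a m =>
    refine Eq.trans ?_ (congrArg (fun z => z ⊗ₜ[ℂ] m) (G.counit.1 a))
    rw [P_tmul]
    induction G.φ a with
    | zero => simp
    | tmul => simp [TensorProduct.smul_tmul']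
    | add u v hu hv => simp only [TensorProduct.add_tmul, map_add, hu, hv]

theorem lTensor_E_P (x : A ⊗[ℂ] M) : 𝕃 (G.E M) (G.P M x) = x := by
  induction x with
  | zero => simp
  | add u v hu hv => simp only [map_add, hu, hv]
  | tmul a m =>
    refine Eq.trans ?_ (congrArg (fun z => z ⊗ₜ[ℂ] m) (G.counit.2 a))
    rw [P_tmul]
    induction G.φ a with
    | zero => simp
    | tmul => simp [TensorProduct.smul_tmul']
    | add u v hu hv => simp only [TensorProduct.add_tmul, map_add, hu, hv]

theorem mu_K_P (x : A ⊗[ℂ] M) : mu M (G.K _ (G.P M x)) = un M (G.E M x) := by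
  induction x with
  | zero => simp
  | add u v hu hv => simp only [map_add, hu, hv]
  | tmul a m =>
    refine Eq.trans ?_ ((congrArg (fun z => z ⊗ₜ[ℂ] m) (G.antipode.1 a)).trans ?_)
    · rw [P_tmul]
      induction G.φ a with
      | zero => simp
      | tmul => simp
      | add u v hu hv => simp only [TensorProduct.add_tmul, map_add, hu, hv]
    · simp [TensorProduct.smul_tmul']

theorem mu_lTensor_K_P (x : A ⊗[ℂ] M) :
    mu M (𝕃 (G.K M) (G.P M x)) = un M (G.E M x) := by
  induction x with
  | zero => simp
  | add u v hu hv => simp only [map_add, hu, hv]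
  | tmul a m =>
    refine Eq.trans ?_ ((congrArg (fun z => z ⊗ₜ[ℂ] m) (G.antipode.2 a)).trans ?_)
    · rw [P_tmul]
      induction G.φ a with
      | zero => simp
      | tmul => simp
      | add u v hu hv => simp only [TensorProduct.add_tmul, map_add, hu, hv]
    · simp [TensorProduct.smul_tmul']

theorem S_lTensor_K (n : ℤ) (x : A ⊗[ℂ] (A ⊗[ℂ] M)) :
    G.S M n (𝕃 (G.K M) x) = G.K _ (G.S M (-n) x) := by
  suffices G.S M n ∘ₗ 𝕃 (G.K M) = G.K _ ∘ₗ G.S M (-n) from LinearMap.congr_fun this x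
  ext a b m
  have h := congrArg (fun z => TensorProduct.assoc ℂ A A M (z ⊗ₜ m))
    (G.braid_antipode n (a ⊗ₜ b))
  simp only [TensorProduct.AlgebraTensorModule.curry_apply, LinearMap.restrictScalars_self,
    TensorProduct.curry_apply, LinearMap.coe_comp, Function.comp_apply, LinearMap.lTensor_tmul,
    S_tmul, K_tmul]
  refine h.trans ?_
  induction G.σ (-n) (a ⊗ₜ b) with
  | zero => simp
  | tmul => simp
  | add u v hu hv => simp only [TensorProduct.add_tmul, map_add, hu, hv]

theorem P_S (n m : ℤ) (x : A ⊗[ℂ] (A ⊗[ℂ] M)) :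
    G.P _ (G.S M (n + m) x) = 𝕃 (G.S M n) (G.S _ m (𝕃 (G.P M) x)) := by
  suffices G.P _ ∘ₗ G.S M (n + m) = 𝕃 (G.S M n) ∘ₗ G.S _ m ∘ₗ 𝕃 (G.P M) from
    LinearMap.congr_fun this x
  ext a b x
  have h := congrArg (fun z => 𝕃 (TensorProduct.assoc ℂ A A M).toLinearMap
      (TensorProduct.assoc ℂ A (A ⊗[ℂ] A) M (TensorProduct.assoc ℂ A A A z ⊗ₜ x)))
    (LinearMap.congr_fun (G.comul_braid n m) (a ⊗ₜ b))
  simp only [TensorProduct.AlgebraTensorModule.curry_apply, LinearMap.restrictScalars_self,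
    TensorProduct.curry_apply, LinearMap.coe_comp, Function.comp_apply, LinearMap.lTensor_tmul,
    S_tmul, P_tmul, LinearEquiv.coe_coe, LinearEquiv.apply_symm_apply] at h ⊢
  refine Eq.trans ?_ (h.trans ?_)
  · induction G.σ (n + m) (a ⊗ₜ b) with
    | zero => simp
    | add u v hu hv => simp only [TensorProduct.add_tmul, map_add, hu, hv]
    | tmul c d =>
      simp only [LinearMap.rTensor_tmul, TensorProduct.assoc_tmul, P_tmul]
      induction G.φ c with
      | zero => simp
      | tmul => simp
      | add u v hu hv => simp only [TensorProduct.add_tmul, map_add, hu, hv]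
  · induction G.φ b with
    | zero => simp
    | add u v hu hv => simp only [TensorProduct.add_tmul, TensorProduct.tmul_add, map_add, hu, hv]
    | tmul c d =>
      simp only [LinearMap.rTensor_tmul, TensorProduct.assoc_tmul, TensorProduct.assoc_symm_tmul,
        S_tmul, LinearEquiv.coe_coe]
      induction G.σ m (a ⊗ₜ c) with
      | zero => simp
      | tmul => simp
      | add u v hu hv => simp only [TensorProduct.add_tmul, map_add, hu, hv]

theorem lTensor_P_S (n m : ℤ) (x : A ⊗[ℂ] (A ⊗[ℂ] M)) :
    𝕃 (G.P M) (G.S M (n + m) x) = G.S _ n (𝕃 (G.S M m) (G.P _ x)) := by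
  suffices 𝕃 (G.P M) ∘ₗ G.S M (n + m) = G.S _ n ∘ₗ 𝕃 (G.S M m) ∘ₗ G.P _ from
    LinearMap.congr_fun this x
  ext a b x
  have h := congrArg (fun z => 𝕃 (TensorProduct.assoc ℂ A A M).toLinearMap
      (TensorProduct.assoc ℂ A (A ⊗[ℂ] A) M (z ⊗ₜ x)))
    (LinearMap.congr_fun (G.comul_braid' n m) (a ⊗ₜ b))
  simp only [TensorProduct.AlgebraTensorModule.curry_apply, LinearMap.restrictScalars_self,
    TensorProduct.curry_apply, LinearMap.coe_comp, Function.comp_apply,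
    S_tmul, P_tmul, LinearEquiv.coe_coe, LinearMap.rTensor_tmul] at h ⊢
  refine Eq.trans ?_ (h.trans ?_)
  · induction G.σ (n + m) (a ⊗ₜ b) with
    | zero => simp
    | tmul => simp
    | add u v hu hv => simp only [TensorProduct.add_tmul, map_add, hu, hv]
  · induction G.φ a with
    | zero => simp
    | add u v hu hv => simp only [TensorProduct.add_tmul, map_add, hu, hv]
    | tmul c d =>
      simp only [LinearMap.lTensor_tmul, TensorProduct.assoc_tmul,
        S_tmul, LinearEquiv.coe_coe]
      induction G.σ m (d ⊗ₜ b) with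
      | zero => simp
      | add u v hu hv =>
        simp only [TensorProduct.add_tmul, TensorProduct.tmul_add, map_add, hu, hv]
      | tmul p q =>
        simp only [TensorProduct.assoc_tmul, TensorProduct.assoc_symm_tmul,
          LinearMap.rTensor_tmul, S_tmul, LinearEquiv.coe_coe]
        induction G.σ n (c ⊗ₜ p) with
        | zero => simp
        | tmul => simp
        | add u v hu hv => simp only [TensorProduct.add_tmul, map_add, hu, hv]

theorem S_one_mu (x : A ⊗[ℂ] (A ⊗[ℂ] (A ⊗[ℂ] M))) :
    G.S M 1 (mu _ x) = 𝕃 (mu M) (G.S _ 1 (𝕃 (G.S M 1) x)) := by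
  suffices G.S M 1 ∘ₗ mu _ = 𝕃 (mu M) ∘ₗ G.S _ 1 ∘ₗ 𝕃 (G.S M 1) from LinearMap.congr_fun this x
  ext a b c x
  simp only [TensorProduct.AlgebraTensorModule.curry_apply, LinearMap.restrictScalars_self,
    TensorProduct.curry_apply, LinearMap.coe_comp, Function.comp_apply,
    S_tmul, mu_tmul, LinearMap.lTensor_tmul]
  have h := congrArg (fun z => TensorProduct.assoc ℂ A A M (z ⊗ₜ x)) (G.braid.1 a b c)
  simp only [LinearEquiv.coe_coe] at h
  refine h.trans ?_
  induction G.σ 1 (b ⊗ₜ c) with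
  | zero => simp
  | add u v hu hv =>
    simp only [TensorProduct.add_tmul, TensorProduct.tmul_add, map_add, hu, hv]
  | tmul p q =>
    simp only [TensorProduct.assoc_tmul, TensorProduct.assoc_symm_tmul,
      LinearMap.rTensor_tmul, S_tmul, LinearEquiv.coe_coe]
    induction G.σ 1 (a ⊗ₜ p) with
    | zero => simp
    | tmul => simp
    | add u v hu hv => simp only [TensorProduct.add_tmul, map_add, hu, hv]

theorem S_one_lTensor_mu (x : A ⊗[ℂ] (A ⊗[ℂ] (A ⊗[ℂ] M))) :
    G.S M 1 (𝕃 (mu M) x) = mu _ (𝕃 (G.S M 1) (G.S _ 1 x)) := by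
  suffices G.S M 1 ∘ₗ 𝕃 (mu M) = mu _ ∘ₗ 𝕃 (G.S M 1) ∘ₗ G.S _ 1 from LinearMap.congr_fun this x
  ext a b c x
  simp only [TensorProduct.AlgebraTensorModule.curry_apply, LinearMap.restrictScalars_self,
    TensorProduct.curry_apply, LinearMap.coe_comp, Function.comp_apply,
    S_tmul, mu_tmul, LinearMap.lTensor_tmul]
  have h := congrArg (fun z => TensorProduct.assoc ℂ A A M (z ⊗ₜ x)) (G.braid.2 a b c)
  simp only [LinearEquiv.coe_coe, LinearMap.rTensor_tmul] at h
  refine h.trans ?_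
  induction G.σ 1 (a ⊗ₜ b) with
  | zero => simp
  | add u v hu hv =>
    simp only [TensorProduct.add_tmul, map_add, hu, hv]
  | tmul p q =>
    simp only [TensorProduct.assoc_tmul,
      LinearMap.lTensor_tmul, S_tmul, LinearEquiv.coe_coe]
    induction G.σ 1 (q ⊗ₜ c) with
    | zero => simp
    | tmul => simp
    | add u v hu hv =>
      simp only [TensorProduct.add_tmul, TensorProduct.tmul_add, map_add, hu, hv]

theorem P_mu (x : A ⊗[ℂ] (A ⊗[ℂ] M)) :
    G.P M (mu M x) = mu _ (𝕃 (𝕃 (mu M)) (𝕃 (G.S _ 1) (G.P _ (𝕃 (G.P M) x)))) := by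
  suffices G.P M ∘ₗ mu M = mu _ ∘ₗ 𝕃 (𝕃 (mu M)) ∘ₗ 𝕃 (G.S _ 1) ∘ₗ G.P _ ∘ₗ 𝕃 (G.P M) from
    LinearMap.congr_fun this x
  ext a b x
  simp only [TensorProduct.AlgebraTensorModule.curry_apply, LinearMap.restrictScalars_self,
    TensorProduct.curry_apply, LinearMap.coe_comp, Function.comp_apply,
    P_tmul, mu_tmul, LinearMap.lTensor_tmul]
  have h := congrArg (fun z => TensorProduct.assoc ℂ A A M (z ⊗ₜ x)) (G.compMul a b)
  refine h.trans ?_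
  induction G.φ a with
  | zero => simp
  | add u v hu hv => simp only [TensorProduct.add_tmul, map_add, hu, hv]
  | tmul p q =>
    induction G.φ b with
    | zero => simp
    | add u v hu hv =>
      simp only [TensorProduct.add_tmul, TensorProduct.tmul_add, map_add, hu, hv]
    | tmul r s =>
      simp only [midBraid, TensorProduct.assoc_tmul, TensorProduct.assoc_symm_tmul,
        LinearMap.lTensor_tmul, LinearMap.rTensor_tmul, S_tmul, LinearEquiv.coe_coe,
        LinearMap.coe_comp, Function.comp_apply]
      induction G.σ 1 (q ⊗ₜ r) with
      | zero => simp
      | tmul => simp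
      | add u v hu hv =>
        simp only [TensorProduct.add_tmul, TensorProduct.tmul_add, map_add, hu, hv]

end Laws

section Derived

variable {M N : Type} [AddCommMonoid M] [Module ℂ M] [AddCommMonoid N] [Module ℂ N]
variable (G : MultiBraided A)

theorem E_S_zero (x : A ⊗[ℂ] (A ⊗[ℂ] M)) : G.E _ (G.S M 0 x) = 𝕃 (G.E M) x := by
  have h := congrArg (G.E _) (G.P_S 0 0 x)
  rw [E_P, E_nat, add_zero] at h
  have h' := congrArg (𝕃 (G.E M)) (G.S_bijective 0 |>.1 h)
  rw [← E_nat, ← S_nat, lift₂₀ G.lTensor_E_P] at h'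
  exact h'.symm

theorem lTensor_E_S_zero (x : A ⊗[ℂ] (A ⊗[ℂ] M)) : 𝕃 (G.E M) (G.S M 0 x) = G.E _ x := by
  have h := congrArg (𝕃 (𝕃 (G.E M))) (G.lTensor_P_S 0 0 x)
  rw [lift₂₀ G.lTensor_E_P, ← S_nat, add_zero] at h
  have h' := congrArg (G.E _) (G.S_bijective 0 |>.1 h)
  rw [E_nat, E_nat, E_P] at h'
  exact h'.symm

/-- Compatibility of the braid operator of index `n` with the multiplication. -/
structure MulCompat (n : ℤ) : Prop where
  S_mu : ∀ {M : Type} [AddCommMonoid M] [Module ℂ M] (x : A ⊗[ℂ] (A ⊗[ℂ] (A ⊗[ℂ] M))),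
    G.S M n (mu _ x) = 𝕃 (mu M) (G.S _ n (𝕃 (G.S M n) x))
  S_lTensor_mu : ∀ {M : Type} [AddCommMonoid M] [Module ℂ M]
    (x : A ⊗[ℂ] (A ⊗[ℂ] (A ⊗[ℂ] M))),
    G.S M n (𝕃 (mu M) x) = mu _ (𝕃 (G.S M n) (G.S _ n x))

theorem mulCompat_one : G.MulCompat 1 := ⟨G.S_one_mu, G.S_one_lTensor_mu⟩

variable {G} in
theorem MulCompat.of_succ {n : ℤ} (h : G.MulCompat (1 + n)) : G.MulCompat n where
  S_mu x := by
    have h₁ := G.P_S 1 n (mu _ x)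
    rw [h.S_mu, P_nat, P_S, lift₂₃ (G.P_S 1 n), S_nat, lift₃₂ (fun x => (G.S_one_mu x).symm),
      ← mu_nat] at h₁
    have h₂ := congrArg (𝕃 (𝕃 (G.E _))) (G.lTensor_S_injective 1 h₁)
    rw [← S_nat, ← mu_nat, ← lift₂₂ (mu_nat _), ← S_nat, ← lift₂₂ (G.S_nat n _),
      lift₂₀ (lift₂₀ G.lTensor_E_P)] at h₂
    exact h₂.symm
  S_lTensor_mu x := by
    have h₁ := G.lTensor_P_S 1 n (𝕃 (mu _) x)
    rw [h.S_lTensor_mu, ← mu_nat, lift₂₃ (G.lTensor_P_S 1 n), G.lTensor_P_S 1 n, ← S_nat,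
      ← S_one_lTensor_mu, P_nat] at h₁
    have h₂ := congrArg (G.E _) ((G.S_bijective 1).1 h₁)
    simp only [E_nat, E_P] at h₂
    exact h₂.symm

variable {G}

theorem MulCompat.S_un {n : ℤ} (h : G.MulCompat n) (x : A ⊗[ℂ] M) :
    G.S M n (un _ x) = 𝕃 (un M) x := by
  obtain ⟨y, hy⟩ := (G.S_bijective n).2 (𝕃 (un M) x)
  have h₁ := h.S_mu (un _ y)
  rw [mu_un, ← un_nat, hy, un_nat, S_nat, lift₂₀ mu_lTensor_un] at h₁
  exact h₁.symm

theorem MulCompat.S_lTensor_un {n : ℤ} (h : G.MulCompat n) (x : A ⊗[ℂ] M) :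
    G.S M n (𝕃 (un M) x) = un _ x := by
  obtain ⟨y, hy⟩ := (G.S_bijective n).2 (un _ x)
  have h₁ := h.S_lTensor_mu (𝕃 (𝕃 (un M)) y)
  rw [lift₂₀ mu_lTensor_un, S_nat, hy, ← un_nat, ← un_nat, mu_un] at h₁
  exact h₁.symm

variable (G) in
theorem lTensor_mu_S_lTensor_K_S (n : ℤ) (x : A ⊗[ℂ] (A ⊗[ℂ] M)) :
    𝕃 (mu M) (G.S _ n (𝕃 (𝕃 (G.K M) ∘ₗ G.S M (-n)) (G.P _ x))) = 𝕃 (un M) (G.E _ x) := by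
  rw [LinearMap.lTensor_comp_apply, S_nat, ← lTensor_P_S, add_neg_cancel,
    lift₃₂ G.mu_lTensor_K_P, lTensor_E_S_zero]

theorem MulCompat.S_K {n : ℤ} (h : G.MulCompat n) (x : A ⊗[ℂ] (A ⊗[ℂ] M)) :
    G.S M n (G.K _ x) = 𝕃 (G.K M) (G.S M (-n) x) := by
  set c := 𝕃 (G.K M) ∘ₗ G.S M (-n) with hc
  have h₁ : 𝕃 (𝕃 (un M)) x =
      𝕃 (𝕃 (mu M)) (𝕃 (G.S _ n) (𝕃 (𝕃 c) (G.P _ (G.P _ x)))) := by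
    have h₂ : ∀ x : A ⊗[ℂ] (A ⊗[ℂ] M),
        (𝕃 (mu M) ∘ₗ G.S _ n ∘ₗ 𝕃 c ∘ₗ G.P _) x = (𝕃 (un M) ∘ₗ G.E _) x :=
      G.lTensor_mu_S_lTensor_K_S n
    have h₃ := lift₁₁ h₂ (G.P _ x)
    simp only [LinearMap.lTensor_comp_apply, lTensor_E_P, P_P] at h₃
    exact h₃.symm
  calc G.S M n (G.K _ x) = 𝕃 (mu M) (G.S _ n (G.K _ (𝕃 (𝕃 (un M)) x))) := by
        rw [K_nat, S_nat, lift₂₀ mu_lTensor_un]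
    _ = 𝕃 (mu M) (G.S _ n (un _ (c x))) := by
        rw [h₁, K_nat, K_nat, K_nat, S_nat, ← lift₂₂ mu_mu, ← h.S_mu, mu_nat, mu_K_P, E_P,
          un_nat]
    _ = c x := by rw [h.S_un, lift₂₀ mu_un]

section YangBaxter

variable {q p : ℤ}

variable (G p) in
theorem mu_K_lTensor_S (D : A ⊗[ℂ] (A ⊗[ℂ] (A ⊗[ℂ] M)) →ₗ[ℂ] A ⊗[ℂ] N)
    (x : A ⊗[ℂ] (A ⊗[ℂ] (A ⊗[ℂ] M))) :
    mu _ (G.K _ (𝕃 (mu _ ∘ₗ 𝕃 D ∘ₗ G.S _ p ∘ₗ 𝕃 (G.P _)) (G.S _ (-p) (𝕃 (G.P _) x)))) =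
      D x := by
  simp only [LinearMap.lTensor_comp_apply]
  rw [← S_nat, lift₂₂ G.P_P, ← P_S, add_neg_cancel, K_nat, K_nat, ← mu_mu, mu_nat, mu_K_P,
    E_S_zero, lift₂₀ G.E_P, ← un_nat, mu_un]

variable (G q p) in
theorem lTensor_mu_K_mu_S (D : ∀ (M : Type) [AddCommMonoid M] [Module ℂ M],
      A ⊗[ℂ] (A ⊗[ℂ] (A ⊗[ℂ] M)) →ₗ[ℂ] A ⊗[ℂ] (A ⊗[ℂ] (A ⊗[ℂ] M)))
    (hD : ∀ {M N : Type} [AddCommMonoid M] [Module ℂ M] [AddCommMonoid N] [Module ℂ N]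
      (g : M →ₗ[ℂ] N) (x : A ⊗[ℂ] (A ⊗[ℂ] (A ⊗[ℂ] M))),
      D N (𝕃 (𝕃 (𝕃 g)) x) = 𝕃 (𝕃 (𝕃 g)) (D M x))
    (x : A ⊗[ℂ] (A ⊗[ℂ] (A ⊗[ℂ] M))) :
    𝕃 (mu _) (𝕃 (𝕃 (G.K _)) (𝕃 (𝕃 (G.S M (-q))) (𝕃 (mu _) (mu _ (𝕃 (𝕃 (𝕃 (G.S _ q)))
      (𝕃 (D _) (G.S _ p (𝕃 (G.P _) (𝕃 (𝕃 (G.P _)) (𝕃 (𝕃 (G.P M)) x)))))))))) =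
      mu _ (𝕃 (D M) (G.S _ p (𝕃 (G.P _) x))) := by
  rw [← lift₂₂ (lift₂₂ G.P_P), lift₂₂ (G.P_nat (𝕃 (G.P M))), S_nat, lift₂₂ (hD (G.P M)),
    ← lift₂₂ (mu_nat (G.S M (-q))), ← mu_nat, ← lift₂₃ (lift₂₃ (lift₂₃ (G.P_S (-q) q))),
    neg_add_cancel, ← lift₂₂ (mu_nat (G.K _)), ← mu_nat, lift₂₂ mu_mu, ← mu_nat,
    lift₃₂ (lift₃₂ (lift₃₂ G.mu_lTensor_K_P)), mu_nat, lift₂₀ mu_lTensor_un,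
    lift₂₁ (lift₂₁ (lift₂₁ G.E_S_zero)), ← lift₂₂ (hD (G.E M)), ← S_nat,
    ← lift₂₂ (G.P_nat (𝕃 (G.E M))), lift₂₀ (lift₂₀ G.lTensor_E_P)]

theorem yangBaxter (hq : G.MulCompat q) (hp : G.MulCompat p) (hqp : G.MulCompat (q + p))
    (x : A ⊗[ℂ] (A ⊗[ℂ] (A ⊗[ℂ] M))) :
    𝕃 (G.S M q) (G.S _ p (𝕃 (G.S M 1) x)) = G.S _ 1 (𝕃 (G.S M p) (G.S _ q x)) := by
  let D₁ (M : Type) [AddCommMonoid M] [Module ℂ M] :=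
    𝕃 (G.S M q) ∘ₗ G.S _ p ∘ₗ 𝕃 (G.S M 1)
  let D₂ (M : Type) [AddCommMonoid M] [Module ℂ M] :=
    G.S _ 1 ∘ₗ 𝕃 (G.S M p) ∘ₗ G.S _ q
  have h₁ {M : Type} [AddCommMonoid M] [Module ℂ M] (x : A ⊗[ℂ] (A ⊗[ℂ] (A ⊗[ℂ] M))) :
      G.P _ (G.S _ (q + p) (𝕃 (mu _) x)) = 𝕃 (mu _) (mu _ (𝕃 (𝕃 (𝕃 (G.S M q)))
        (𝕃 (D₁ _) (G.S _ p (𝕃 (G.P _) (𝕃 (𝕃 (G.P _)) x)))))) := by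
    simp only [D₁, LinearMap.lTensor_comp_apply]
    rw [P_S, lift₂₅ G.P_mu, hp.S_lTensor_mu, S_nat, lift₂₂ (G.S_nat p _), mu_nat,
      lift₂₃ hq.S_lTensor_mu, ← mu_nat, ← mu_nat, S_nat]
  have h₂ {M : Type} [AddCommMonoid M] [Module ℂ M] (x : A ⊗[ℂ] (A ⊗[ℂ] (A ⊗[ℂ] M))) :
      G.P _ (G.S _ (q + p) (𝕃 (mu _) x)) = 𝕃 (mu _) (mu _ (𝕃 (𝕃 (𝕃 (G.S M q)))
        (𝕃 (D₂ _) (G.S _ p (𝕃 (G.P _) (𝕃 (𝕃 (G.P _)) x)))))) := by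
    simp only [D₂, LinearMap.lTensor_comp_apply]
    rw [hqp.S_lTensor_mu, P_mu, lift₂₃ (G.P_S q p), ← S_nat, P_nat, P_nat, P_S,
      lift₂₂ (G.S_nat 1 _), ← mu_nat]
  have h₃ {M : Type} [AddCommMonoid M] [Module ℂ M] (x : A ⊗[ℂ] (A ⊗[ℂ] (A ⊗[ℂ] M))) :
      mu _ (𝕃 (D₁ M) (G.S _ p (𝕃 (G.P _) x))) = mu _ (𝕃 (D₂ M) (G.S _ p (𝕃 (G.P _) x))) := by
    rw [← lTensor_mu_K_mu_S G q p D₁, ← lTensor_mu_K_mu_S G q p D₂, ← h₁, ← h₂]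
    · intros
      simp only [D₂, LinearMap.comp_apply, S_nat, lift₂₂ (G.S_nat _ _)]
    · intros
      simp only [D₁, LinearMap.comp_apply, S_nat, lift₂₂ (G.S_nat _ _)]
  have h₄ := mu_K_lTensor_S G p (D₁ M) x
  rw [show mu _ ∘ₗ 𝕃 (D₁ M) ∘ₗ G.S _ p ∘ₗ 𝕃 (G.P _) = mu _ ∘ₗ 𝕃 (D₂ M) ∘ₗ G.S _ p ∘ₗ 𝕃 (G.P _)
    from LinearMap.ext h₃, mu_K_lTensor_S] at h₄
  exact h₄.symm

theorem yangBaxter_zero (hq : G.MulCompat q) (hp : G.MulCompat p) (h₀ : G.MulCompat 0)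
    (hqp : G.MulCompat (q + p)) (x : A ⊗[ℂ] (A ⊗[ℂ] (A ⊗[ℂ] M))) :
    𝕃 (G.S M q) (G.S _ p (𝕃 (G.S M 0) x)) = G.S _ 0 (𝕃 (G.S M p) (G.S _ q x)) := by
  have h₁ := G.lTensor_P_S 1 0 (𝕃 (G.S M p) (G.S _ q x))
  have h₂ := G.P_S (M := M) q 0
  have h₃ := G.lTensor_P_S (M := M) 1 0
  rw [add_zero] at h₁ h₂ h₃
  rw [← yangBaxter hq hp hqp, lift₂₃ h₂, ← S_nat, lift₂₃ h₃,
    yangBaxter h₀ hp ((zero_add p).symm ▸ hp), ← S_nat] at h₁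
  have h₄ := congrArg (G.E _) ((G.S_bijective 1).1 h₁)
  rw [E_nat, E_nat, E_nat, E_P, E_S_zero, lift₂₂ (G.E_nat (G.S M 0)), lift₂₀ G.E_P] at h₄
  exact h₄

end YangBaxter

variable (G) in
theorem mulCompat_zero : G.MulCompat 0 := MulCompat.of_succ G.mulCompat_one

variable (G) in
theorem mulCompat_neg_one : G.MulCompat (-1) := MulCompat.of_succ G.mulCompat_zero

variable (G M) in
/-- The adjoint action on the first factor. -/
def ad : A ⊗[ℂ] M →ₗ[ℂ] A ⊗[ℂ] (A ⊗[ℂ] M) :=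
  𝕃 (mu M) ∘ₗ 𝕃 (G.K _) ∘ₗ G.S _ 0 ∘ₗ 𝕃 (G.P _) ∘ₗ G.P _

variable (G)

theorem ad_apply (x : A ⊗[ℂ] M) :
    G.ad M x = 𝕃 (mu M) (𝕃 (G.K _) (G.S _ 0 (𝕃 (G.P _) (G.P _ x)))) := rfl

theorem ad_nat (g : M →ₗ[ℂ] N) (x : A ⊗[ℂ] M) :
    G.ad N (𝕃 g x) = 𝕃 (𝕃 g) (G.ad M x) := by
  rw [ad_apply, ad_apply, P_nat, lift₂₂ (G.P_nat g), S_nat, lift₂₂ (G.K_nat _),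
    lift₂₂ (mu_nat g)]

theorem S_zero_lTensor_ad (x : A ⊗[ℂ] (A ⊗[ℂ] M)) :
    G.S _ 0 (𝕃 (G.ad M) x) =
      𝕃 (𝕃 (mu M)) (𝕃 (𝕃 (G.K _)) (G.S _ 0 (𝕃 (G.S _ 0) (𝕃 (𝕃 (G.P _)) (𝕃 (G.P _) x))))) := by
  simp only [ad, LinearMap.lTensor_comp_apply, S_nat]

theorem ad_S_zero (x : A ⊗[ℂ] (A ⊗[ℂ] M)) :
    G.ad _ (G.S M 0 x) = 𝕃 (G.S M 1) (G.S _ 0 (𝕃 (G.ad M) x)) := by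
  have h₁ := G.P_S (M := M) 1 0
  rw [add_zero] at h₁
  rw [S_zero_lTensor_ad, lift₂₃ G.S_one_lTensor_mu, lift₂₂ (G.S_lTensor_K 1),
    ← lift₂₂ (G.K_nat (G.S M 1)),
    yangBaxter_zero G.mulCompat_neg_one G.mulCompat_zero G.mulCompat_zero G.mulCompat_neg_one,
    ← S_nat, G.S_nat (-1), ← lift₂₃ h₁, ← P_S, add_neg_cancel, ad_apply]

theorem lTensor_mu_S_zero_lTensor_ad_P (x : A ⊗[ℂ] M) :
    𝕃 (mu _) (G.S _ 0 (𝕃 (G.ad M) (G.P _ x))) = G.P _ x := by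
  rw [S_zero_lTensor_ad, ← lift₂₂ mu_mu, P_P, ← P_nat, P_P, ← G.lTensor_P_S 0 0, add_zero,
    lift₃₂ G.mu_lTensor_K_P, lift₂₀ mu_un, lTensor_E_S_zero, E_P]

variable (M) in
/-- The braided product of the square of `A`, acting on the first four factors. -/
def star : A ⊗[ℂ] (A ⊗[ℂ] (A ⊗[ℂ] (A ⊗[ℂ] M))) →ₗ[ℂ] A ⊗[ℂ] (A ⊗[ℂ] M) :=
  mu _ ∘ₗ 𝕃 (𝕃 (mu M)) ∘ₗ 𝕃 (G.S _ 1)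

theorem star_apply (x : A ⊗[ℂ] (A ⊗[ℂ] (A ⊗[ℂ] (A ⊗[ℂ] M)))) :
    G.star M x = mu _ (𝕃 (𝕃 (mu M)) (𝕃 (G.S _ 1) x)) := rfl

theorem star_star (x : A ⊗[ℂ] (A ⊗[ℂ] (A ⊗[ℂ] (A ⊗[ℂ] (A ⊗[ℂ] (A ⊗[ℂ] M)))))) :
    G.star M (G.star _ x) = G.star M (𝕃 (𝕃 (G.star M)) x) := by
  simp only [star, LinearMap.lTensor_comp, LinearMap.comp_apply]
  rw [← mu_nat, lift₂₃ (lift₂₃ G.S_one_mu), ← mu_nat, lift₂₃ G.S_one_lTensor_mu,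
    lift₂₂ (G.S_nat 1 (𝕃 (mu M))), lift₂₂ (lift₂₂ (G.S_nat 1 (mu M))),
    lift₂₂ (mu_nat (𝕃 (mu M))), ← lift₂₂ (lift₂₂ mu_mu), ← lift₂₂ (mu_nat (mu _)),
    ← lift₂₂ (mu_nat (mu _)), ← mu_mu, lift₂₂ (G.S_nat 1 (G.S _ 1))]

variable (M) in
/-- Comultiplication of the first factor followed by the braided product with the next two. -/
def starP : A ⊗[ℂ] (A ⊗[ℂ] (A ⊗[ℂ] M)) →ₗ[ℂ] A ⊗[ℂ] (A ⊗[ℂ] M) :=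
  G.star M ∘ₗ G.P _

theorem starP_apply (x : A ⊗[ℂ] (A ⊗[ℂ] (A ⊗[ℂ] M))) :
    G.starP M x = G.star M (G.P _ x) := rfl

theorem starP_lTensor_P (x : A ⊗[ℂ] (A ⊗[ℂ] M)) : G.starP M (𝕃 (G.P M) x) = G.P M (mu M x) :=
  (G.P_mu x).symm

theorem starP_mu (x : A ⊗[ℂ] (A ⊗[ℂ] (A ⊗[ℂ] (A ⊗[ℂ] M)))) :
    G.starP M (mu _ x) = G.starP M (𝕃 (G.starP M) x) := by
  rw [starP_apply, P_mu, ← star_apply, star_star, starP_apply, ← P_nat, starP,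
    LinearMap.lTensor_comp_apply]

theorem starP_lTensor_lTensor_mu (x : A ⊗[ℂ] (A ⊗[ℂ] (A ⊗[ℂ] (A ⊗[ℂ] M)))) :
    G.starP M (𝕃 (𝕃 (mu M)) x) = 𝕃 (mu M) (G.starP _ x) := by
  simp only [starP_apply, star_apply]
  rw [P_nat, lift₂₂ (G.S_nat 1 _), ← lift₂₂ (lift₂₂ mu_mu), mu_nat]

theorem starP_un (x : A ⊗[ℂ] (A ⊗[ℂ] M)) : G.starP M (un _ x) = x := by
  have h₁ : 𝕃 (mu M) (G.P _ (𝕃 (mu M) (𝕃 (G.K _) (G.P _ x)))) = x := by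
    rw [P_nat, P_nat, ← lift₂₂ mu_mu, ← P_P, lift₃₂ G.mu_lTensor_K_P, lift₂₀ mu_un, lTensor_E_P]
  rw [← h₁, un_nat, starP_lTensor_lTensor_mu, un_nat, starP_lTensor_P, mu_un]

theorem P_un (x : M) : G.P M (un M x) = un _ (un _ x) := by
  have h₁ := G.starP_un (un _ (un M x))
  rw [un_nat (un M) x, un_nat (𝕃 (un M)), un_nat (un M) x, starP_apply, P_nat, P_nat,
    star_apply] at h₁
  rw [lift₂₂ (lift₂₂ (fun x => (un_nat (un M) x).symm)), lift₂₁ G.mulCompat_one.S_lTensor_un,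
    lift₂₂ (fun x => (un_nat (mu M) x).symm), mu_lTensor_un, lift₂₀ mu_lTensor_un,
    ← un_nat] at h₁
  exact h₁

theorem E_un (x : A ⊗[ℂ] M) : G.E _ (un _ x) = x := by
  have h₁ := G.E_P (un _ x)
  rw [P_un, un_nat (un _), E_nat] at h₁
  simpa only [mu_un] using congrArg (mu _) h₁

section Coassoc

variable (M) in
/-- Action on the last three factors used to characterise the adjoint action. -/
def act : A ⊗[ℂ] (A ⊗[ℂ] (A ⊗[ℂ] (A ⊗[ℂ] M))) →ₗ[ℂ] A ⊗[ℂ] (A ⊗[ℂ] (A ⊗[ℂ] M)) :=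
  𝕃 (G.starP M) ∘ₗ G.S _ 0

theorem act_apply (x : A ⊗[ℂ] (A ⊗[ℂ] (A ⊗[ℂ] (A ⊗[ℂ] M)))) :
    G.act M x = 𝕃 (G.starP M) (G.S _ 0 x) := rfl

theorem act_un (x : A ⊗[ℂ] (A ⊗[ℂ] (A ⊗[ℂ] M))) : G.act M (un _ x) = x := by
  rw [act_apply, G.mulCompat_zero.S_un, lift₂₀ G.starP_un]

theorem act_mu (x : A ⊗[ℂ] (A ⊗[ℂ] (A ⊗[ℂ] (A ⊗[ℂ] (A ⊗[ℂ] M))))) :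
    G.act M (mu _ x) = G.act M (𝕃 (G.act M) x) := by
  rw [act_apply, G.mulCompat_zero.S_mu, lift₂₂ G.starP_mu, ← S_nat, act_apply, act,
    LinearMap.lTensor_comp_apply]

variable {G} in
theorem eq_act_K_of_act_eq (Y : A ⊗[ℂ] M →ₗ[ℂ] A ⊗[ℂ] (A ⊗[ℂ] (A ⊗[ℂ] M)))
    (hY : ∀ x, G.act M (𝕃 Y (G.P _ x)) = G.P _ (G.P _ x)) (x : A ⊗[ℂ] M) :
    Y x = G.act M (G.K _ (𝕃 (G.P _) (𝕃 (G.P _) (G.P _ x)))) := by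
  rw [← lift₃₂ hY, P_P, K_nat, K_nat, ← act_mu, mu_nat, mu_K_P, E_P, ← un_nat, act_un]

theorem ad_ad (x : A ⊗[ℂ] M) : G.ad _ (G.ad M x) = 𝕃 (G.P M) (G.ad M x) := by
  have h₁ (x : A ⊗[ℂ] M) : G.act M (𝕃 (𝕃 (G.P M) ∘ₗ G.ad M) (G.P _ x)) = G.P _ (G.P _ x) := by
    rw [LinearMap.lTensor_comp_apply, act_apply, S_nat, lift₂₂ G.starP_lTensor_P,
      lTensor_mu_S_zero_lTensor_ad_P, P_P]
  have h₂ (x : A ⊗[ℂ] M) : G.act M (𝕃 (G.ad _ ∘ₗ G.ad M) (G.P _ x)) = G.P _ (G.P _ x) := by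
    have h := G.lTensor_P_S (M := A ⊗[ℂ] (A ⊗[ℂ] M)) 0 0
    rw [add_zero] at h
    simp only [act_apply, starP, star, LinearMap.lTensor_comp_apply]
    rw [h, P_nat, P_nat, ← S_nat, ← lift₂₃ G.ad_S_zero, ← S_nat, ← lift₂₂ (G.ad_nat (mu M)),
      ← P_P, lift₄₁ G.lTensor_mu_S_zero_lTensor_ad_P, P_P, lTensor_mu_S_zero_lTensor_ad_P]
  exact (eq_act_K_of_act_eq _ h₂ x).trans (eq_act_K_of_act_eq _ h₁ x).symm

end Coassoc

section Counit

theorem E_mu_lTensor_S_one_P (x : A ⊗[ℂ] (A ⊗[ℂ] M)) :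
    G.E _ (mu _ (𝕃 (G.S M 1) (G.P _ x))) = 𝕃 (G.E M) x := by
  have h₁ := congrArg (G.E _) (G.P_mu (𝕃 (G.P M) x))
  rw [E_P, mu_nat, E_nat, ← lift₂₂ G.P_P, P_nat, lift₂₂ (G.S_nat 1 _), mu_nat, E_nat] at h₁
  have h₂ := congrArg (fun y => mu _ (𝕃 (G.K _) y)) h₁
  simp only [← mu_nat] at h₂
  rw [mu_mu, mu_mu, lift₃₂ G.mu_lTensor_K_P, lift₃₂ G.mu_lTensor_K_P, mu_lTensor_un,
    mu_lTensor_un, ← E_nat, ← mu_nat, ← lift₂₂ (G.S_nat 1 _), ← P_nat, lift₂₀ G.lTensor_E_P] at h₂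
  exact h₂.symm

theorem E_mu (x : A ⊗[ℂ] (A ⊗[ℂ] M)) : G.E _ (mu _ x) = G.E _ (G.E _ (G.S M (-1) x)) := by
  obtain ⟨y, hy⟩ := (G.S_bijective 1).2 (G.S M 0 x)
  have h₁ : x = 𝕃 (𝕃 (G.E M)) (𝕃 (G.S M 1) (G.P _ y)) := by
    apply (G.S_bijective 0).1
    rw [S_nat, ← G.lTensor_P_S, zero_add, lift₂₀ G.lTensor_E_P, hy]
  rw [h₁, mu_nat, E_nat, E_mu_lTensor_S_one_P, S_nat, ← G.lTensor_P_S, neg_add_cancel, E_nat,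
    E_nat, E_nat, E_nat, E_P, E_S_zero, E_nat]

theorem lTensor_E_S_neg_one (x : A ⊗[ℂ] (A ⊗[ℂ] M)) :
    𝕃 (G.E M) (G.S M (-1) x) = G.E _ (mu _ (𝕃 (G.P M) x)) := by
  have h := G.P_S 0 (-1) x
  rw [zero_add] at h
  rw [E_mu, ← lTensor_E_S_zero, ← E_nat, ← h, E_P]

theorem lTensor_E_ad (x : A ⊗[ℂ] M) : 𝕃 (G.E M) (G.ad M x) = x := by
  have h := G.P_S 1 0 (G.P M x)
  rw [add_zero] at h
  rw [ad_apply, lift₂₃ G.E_mu, lift₂₂ G.mulCompat_neg_one.S_K, neg_neg, ← h,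
    lift₂₂ (G.E_nat (G.K M)), G.lTensor_E_P]
  have h₁ := G.mulCompat_neg_one.S_K (G.P M x)
  rw [neg_neg] at h₁
  rw [← h₁, lTensor_E_S_neg_one, ← K_nat, P_P, mu_K_P, E_P, E_un]

end Counit

theorem ad_tmul (a : A) (x : M) :
    G.ad M (a ⊗ₜ x) = TensorProduct.assoc ℂ A A M
      ((LinearMap.lTensor A (LinearMap.mul' ℂ A) ∘ₗ
        LinearMap.lTensor A (LinearMap.rTensor A G.κ) ∘ₗ
        (TensorProduct.assoc ℂ A A A).toLinearMap ∘ₗ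
        LinearMap.rTensor A (G.σ 0).toLinearMap ∘ₗ
        (TensorProduct.assoc ℂ A A A).symm.toLinearMap ∘ₗ
        LinearMap.lTensor A G.φ ∘ₗ G.φ) a ⊗ₜ x) := by
  simp only [ad_apply, P_tmul, LinearMap.coe_comp, Function.comp_apply, LinearEquiv.coe_coe]
  induction G.φ a with
  | zero => simp
  | add u v hu hv => simp only [TensorProduct.add_tmul, map_add, hu, hv]
  | tmul b c =>
    simp only [TensorProduct.assoc_tmul, LinearMap.lTensor_tmul, P_tmul]
    induction G.φ c with
    | zero => simp
    | add u v hu hv =>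
      simp only [TensorProduct.add_tmul, TensorProduct.tmul_add, map_add, hu, hv]
    | tmul p q =>
      simp only [TensorProduct.assoc_tmul, TensorProduct.assoc_symm_tmul,
        LinearMap.rTensor_tmul, S_tmul, LinearEquiv.coe_coe]
      induction G.σ 0 (b ⊗ₜ p) with
      | zero => simp
      | tmul => simp
      | add u v hu hv => simp only [TensorProduct.add_tmul, map_add, hu, hv]

end Derived

end MultiBraided

/-- The braided adjoint action `ad = (id⊗m)(id⊗κ⊗id)(τ⊗id)(id⊗φ)φ` of a
multi-braided quantum group on itself is counital and coassociative:
`(id⊗ε)ad = id` and `(id⊗φ)ad = (ad⊗id)ad`. -/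
theorem stmt_17 (σ τ : A ⊗[ℂ] A ≃ₗ[ℂ] A ⊗[ℂ] A)
    (hσ : IsBraid σ.toLinearMap)
    (φ : A →ₗ[ℂ] A ⊗[ℂ] A) (ε : A →ₗ[ℂ] ℂ) (κ : A ≃ₗ[ℂ] A)
    (hφm : CompMul φ σ.toLinearMap) (hco : IsCoassoc φ) (hε : IsCounit φ ε)
    (hκ : IsAntipode φ ε κ.toLinearMap)
    (hτ : IsTau φ ε σ τ.toLinearMap)
    (σn : ℤ → (A ⊗[ℂ] A ≃ₗ[ℂ] A ⊗[ℂ] A))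
    (hσn1 : σn 1 = σ) (hσn0 : σn 0 = τ)
    (hrec : ∀ n : ℤ, σn (n + 1) = (σn n).trans (τ.symm.trans σ))
    (hφσ : ∀ n m : ℤ,
      LinearMap.rTensor A φ ∘ₗ (σn (n + m)).toLinearMap =
        (TensorProduct.assoc ℂ A A A).symm.toLinearMap ∘ₗ
          LinearMap.lTensor A (σn n).toLinearMap ∘ₗ
          (TensorProduct.assoc ℂ A A A).toLinearMap ∘ₗ
          LinearMap.rTensor A (σn m).toLinearMap ∘ₗ
          (TensorProduct.assoc ℂ A A A).symm.toLinearMap ∘ₗ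
          LinearMap.lTensor A φ)
    (hφσ' : ∀ n m : ℤ,
      LinearMap.lTensor A φ ∘ₗ (σn (n + m)).toLinearMap =
        (TensorProduct.assoc ℂ A A A).toLinearMap ∘ₗ
          LinearMap.rTensor A (σn n).toLinearMap ∘ₗ
          (TensorProduct.assoc ℂ A A A).symm.toLinearMap ∘ₗ
          LinearMap.lTensor A (σn m).toLinearMap ∘ₗ
          (TensorProduct.assoc ℂ A A A).toLinearMap ∘ₗ
          LinearMap.rTensor A φ)
    (hκn : ∀ (n : ℤ) (x : A ⊗[ℂ] A),
      (σn n) ((TensorProduct.map (LinearMap.id : A →ₗ[ℂ] A) κ.toLinearMap) x) =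
        (TensorProduct.map κ.toLinearMap (LinearMap.id : A →ₗ[ℂ] A)) ((σn (-n)) x)) :
    let ad : A →ₗ[ℂ] A ⊗[ℂ] A :=
      LinearMap.lTensor A (LinearMap.mul' ℂ A) ∘ₗ
        LinearMap.lTensor A (LinearMap.rTensor A κ.toLinearMap) ∘ₗ
        (TensorProduct.assoc ℂ A A A).toLinearMap ∘ₗ
        LinearMap.rTensor A τ.toLinearMap ∘ₗ
        (TensorProduct.assoc ℂ A A A).symm.toLinearMap ∘ₗ
        LinearMap.lTensor A φ ∘ₗ φ
    (∀ a : A, (TensorProduct.rid ℂ A) ((LinearMap.lTensor A ε) (ad a)) = a) ∧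
      (∀ a : A, (TensorProduct.assoc ℂ A A A) ((LinearMap.rTensor A ad) (ad a)) =
        (LinearMap.lTensor A φ) (ad a)) := by

  subst hσn1 hσn0
  intro ad
  let G : MultiBraided A := ⟨σn, φ, ε, κ.toLinearMap, hσ, hφm, hco, hε, hκ, hφσ, hφσ', hκn⟩
  have h₁ : ∀ {M : Type} [AddCommMonoid M] [Module ℂ M] (a : A) (x : M),
      G.ad M (a ⊗ₜ x) = TensorProduct.assoc ℂ A A M (ad a ⊗ₜ x) :=
    fun a x => G.ad_tmul a x
  constructor
  · intro a
    have h := G.lTensor_E_ad (a ⊗ₜ[ℂ] (1 : ℂ))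
    rw [h₁] at h
    refine Eq.trans ?_ ((congrArg (TensorProduct.rid ℂ A) h).trans (by simp))
    congr 1
    induction ad a with
    | zero => simp
    | tmul => simp [G]
    | add u v hu hv => simp only [TensorProduct.add_tmul, map_add, hu, hv]
  · intro a
    have h := congrArg (LinearMap.lTensor A
      (LinearMap.lTensor A (TensorProduct.rid ℂ A).toLinearMap)) (G.ad_ad (a ⊗ₜ[ℂ] (1 : ℂ)))
    rw [h₁] at h
    refine Eq.trans ?_ (h.trans ?_)
    · induction ad a with
      | zero => simp
      | add u v hu hv => simp only [TensorProduct.add_tmul, map_add, hu, hv]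
      | tmul b c =>
        rw [TensorProduct.assoc_tmul, h₁, LinearMap.rTensor_tmul]
        induction ad b with
        | zero => simp
        | tmul => simp
        | add u v hu hv => simp only [TensorProduct.add_tmul, map_add, hu, hv]
    · induction ad a with
      | zero => simp
      | add u v hu hv => simp only [TensorProduct.add_tmul, map_add, hu, hv]
      | tmul b c =>
        simp only [TensorProduct.assoc_tmul, LinearMap.lTensor_tmul, MultiBraided.P_tmul]
        congr 1
        change _ = φ c
        change LinearMap.lTensor A _ (TensorProduct.assoc ℂ A A ℂ (φ c ⊗ₜ 1)) = _
        induction φ c with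
        | zero => simp
        | tmul => simp
        | add u v hu hv => simp only [TensorProduct.add_tmul, map_add, hu, hv]
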